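/- arXiv:1110.5724 — 7 statements merged into one kernel-verified Lean document; each statement's English description precedes it below -/
import Mathlib

section
/- Let m, q ≥ 1 be natural numbers, let M : Matrix (Fin m) (Fin m) ℝ and Q : Matrix (Fin q) (Fin q) ℝ be positive semidefinite symmetric matrices, and let λ > 0 be a real number. Assume: the kernel of the linear map M.mulVecLin is one-dimensional, and every eigenvalue μ of M satisfies μ = 0 or μ ≥ λ; and the same two conditions hold for Q. Then the Kronecker sum S = (1 : Matrix (Fin q) (Fin q) ℝ) ⊗ₖ M + Q ⊗ₖ (1 : Matrix (Fin m) (Fin m) ℝ) is positive semidefinite, the kernel of S.mulVecLin is one-dimensional, and every eigenvalue μ of S satisfies μ = 0 or μ ≥ λ. -/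
open Kronecker

open Matrix in
lemma aux_one_kron {m q : ℕ} (M : Matrix (Fin m) (Fin m) ℝ) (x : Fin q × Fin m → ℝ) (i : Fin q) (j : Fin m) :
    (((1 : Matrix (Fin q) (Fin q) ℝ) ⊗ₖ M) *ᵥ x) (i, j) = (M *ᵥ fun j' => x (i, j')) j := by
  simp only [Matrix.mulVec, dotProduct, Fintype.sum_prod_type, Matrix.kroneckerMap_apply]
  rw [Finset.sum_eq_single i]
  · simp
  · intro b _ hb
    simp [Matrix.one_apply_ne hb.symm]
  · simp

open Matrix in
lemma aux_kron_one {m q : ℕ} (Q : Matrix (Fin q) (Fin q) ℝ) (x : Fin q × Fin m → ℝ) (i : Fin q) (j : Fin m) :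
    ((Q ⊗ₖ (1 : Matrix (Fin m) (Fin m) ℝ)) *ᵥ x) (i, j) = (Q *ᵥ fun i' => x (i', j)) i := by
  simp only [Matrix.mulVec, dotProduct, Fintype.sum_prod_type, Matrix.kroneckerMap_apply]
  refine Finset.sum_congr rfl fun b _ => ?_
  rw [Finset.sum_eq_single j]
  · simp
  · intro b _ hb
    simp [Matrix.one_apply_ne hb.symm]
  · simp

open Matrix in
lemma aux_exists_eig {m : ℕ} (M : Matrix (Fin m) (Fin m) ℝ) (hM : M.IsHermitian) (r : Fin m → ℝ)
    (hr : r ≠ 0) : ∃ (v : Fin m → ℝ) (l : ℝ), v ≠ 0 ∧ M *ᵥ v = l • v ∧ r ⬝ᵥ v ≠ 0 := by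
  by_contra! h
  apply hr
  have hz : ∀ j, inner ℝ (hM.eigenvectorBasis j) (WithLp.toLp 2 r) = 0 := by
    intro j
    have h1 := h (hM.eigenvectorBasis j).ofLp (hM.eigenvalues j) (by
      intro h0
      apply hM.eigenvectorBasis.orthonormal.ne_zero j
      ext k
      exact congrFun h0 k) (hM.mulVec_eigenvectorBasis j)
    rw [EuclideanSpace.inner_eq_star_dotProduct]
    simpa using h1
  have : WithLp.toLp 2 r = 0 := by
    rw [← hM.eigenvectorBasis.sum_repr' (WithLp.toLp 2 r)]
    simp [hz]
  simpa using this

/-- Spectral properties of the Kronecker sum: if `M` and `Q` are symmetric PSD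
matrices whose kernels are one-dimensional and whose nonzero eigenvalues are
at least `lam`, then the Kronecker sum `I ⊗ₖ M + Q ⊗ₖ I` is PSD, has
one-dimensional kernel, and all its nonzero eigenvalues are at least `lam`. -/
theorem stmt_2 (m q : ℕ) (hm : 1 ≤ m) (hq : 1 ≤ q)
    (M : Matrix (Fin m) (Fin m) ℝ) (Q : Matrix (Fin q) (Fin q) ℝ)
    (lam : ℝ) (hlam : 0 < lam)
    (hMsymm : M.IsSymm) (hMpsd : M.PosSemidef)
    (hQsymm : Q.IsSymm) (hQpsd : Q.PosSemidef)
    (hMker : Module.finrank ℝ (LinearMap.ker M.mulVecLin) = 1)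
    (hQker : Module.finrank ℝ (LinearMap.ker Q.mulVecLin) = 1)
    (hMeig : ∀ μ : ℝ, (∃ x : Fin m → ℝ, x ≠ 0 ∧ M.mulVec x = μ • x) →
      μ = 0 ∨ lam ≤ μ)
    (hQeig : ∀ μ : ℝ, (∃ x : Fin q → ℝ, x ≠ 0 ∧ Q.mulVec x = μ • x) →
      μ = 0 ∨ lam ≤ μ) :
    let S : Matrix (Fin q × Fin m) (Fin q × Fin m) ℝ :=
      (1 : Matrix (Fin q) (Fin q) ℝ) ⊗ₖ M + Q ⊗ₖ (1 : Matrix (Fin m) (Fin m) ℝ)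
    S.PosSemidef ∧
    Module.finrank ℝ (LinearMap.ker S.mulVecLin) = 1 ∧
    (∀ μ : ℝ, (∃ x : Fin q × Fin m → ℝ, x ≠ 0 ∧ S.mulVec x = μ • x) →
      μ = 0 ∨ lam ≤ μ) := by
  classical
  intro S
  have hS : ∀ x i j, (S.mulVec x) (i, j) =
      (M.mulVec fun j' => x (i, j')) j + (Q.mulVec fun i' => x (i', j)) i := by
    intro x i j
    simp only [S, Matrix.add_mulVec, Pi.add_apply, aux_one_kron, aux_kron_one]
  have hA : ((1 : Matrix (Fin q) (Fin q) ℝ) ⊗ₖ M).PosSemidef := Matrix.PosSemidef.one.kronecker hMpsd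
  have hB : (Q ⊗ₖ (1 : Matrix (Fin m) (Fin m) ℝ)).PosSemidef := hQpsd.kronecker Matrix.PosSemidef.one
  refine ⟨hA.add hB, ?_, ?_⟩
  · obtain ⟨⟨v, hv⟩, hv0, hvs⟩ := finrank_eq_one_iff'.mp hMker
    obtain ⟨⟨w, hw⟩, hw0, hws⟩ := finrank_eq_one_iff'.mp hQker
    have hv0 : v ≠ 0 := fun h => hv0 (by simpa using h)
    have hw0 : w ≠ 0 := fun h => hw0 (by simpa using h)
    have hv' : M.mulVec v = 0 := by simpa using hv
    have hw' : Q.mulVec w = 0 := by simpa using hw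
    obtain ⟨j0, hj0⟩ := Function.ne_iff.mp hv0
    obtain ⟨i0, hi0⟩ := Function.ne_iff.mp hw0
    simp only [Pi.zero_apply] at hj0 hi0
    have hz : S.mulVec (fun p => w p.1 * v p.2) = 0 := by
      ext ⟨i, j⟩
      rw [hS]
      have e1 : (fun j' => w i * v j') = w i • v := rfl
      have e2 : (fun i' => w i' * v j) = v j • w := by ext; simp [mul_comm]
      simp only [e1, e2, Matrix.mulVec_smul, hv', hw']
      simp
    refine finrank_eq_one_iff'.mpr ⟨⟨fun p => w p.1 * v p.2, by simpa using hz⟩, ?_, ?_⟩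
    · intro h
      have := congrFun (congrArg Subtype.val h) (i0, j0)
      simp [hi0, hj0] at this
    · rintro ⟨x, hx⟩
      have hx : S.mulVec x = 0 := by simpa using hx
      have hsum : star x ⬝ᵥ (((1 : Matrix (Fin q) (Fin q) ℝ) ⊗ₖ M).mulVec x) +
          star x ⬝ᵥ ((Q ⊗ₖ (1 : Matrix (Fin m) (Fin m) ℝ)).mulVec x) = 0 := by
        rw [← dotProduct_add, ← Matrix.add_mulVec]
        change star x ⬝ᵥ S.mulVec x = 0
        rw [hx, dotProduct_zero]
      have nA := hA.dotProduct_mulVec_nonneg x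
      have nB := hB.dotProduct_mulVec_nonneg x
      have zA := (hA.dotProduct_mulVec_zero_iff x).mp (by linarith)
      have zB := (hB.dotProduct_mulVec_zero_iff x).mp (by linarith)
      have rows : ∀ i, ∃ c : ℝ, ∀ j, x (i, j) = c * v j := by
        intro i
        obtain ⟨c, hc⟩ := hvs ⟨fun j => x (i, j), by
          rw [LinearMap.mem_ker, Matrix.mulVecLin_apply]
          ext j
          rw [← aux_one_kron, zA]; rfl⟩
        exact ⟨c, fun j => (congrFun (congrArg Subtype.val hc) j).symm⟩
      obtain ⟨c, hc⟩ := hws ⟨fun i => x (i, j0), by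
          rw [LinearMap.mem_ker, Matrix.mulVecLin_apply]
          ext i
          rw [← aux_kron_one, zB]; rfl⟩
      have hc : ∀ i, c * w i = x (i, j0) := fun i => congrFun (congrArg Subtype.val hc) i
      refine ⟨c / v j0, ?_⟩
      apply Subtype.ext
      ext ⟨i, j⟩
      obtain ⟨d, hd⟩ := rows i
      change c / v j0 * (w i * v j) = x (i, j)
      have h1 := hc i
      rw [hd] at h1
      rw [hd]
      field_simp
      linear_combination v j * h1
  · rintro μ ⟨x, hx0, hx⟩
    obtain ⟨⟨i0, j0⟩, hij⟩ := Function.ne_iff.mp hx0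
    obtain ⟨v, l, hv0, hv, hrv⟩ := aux_exists_eig M hMpsd.1 (fun j => x (i0, j))
      (fun h => hij (congrFun h j0))
    have hl := hMeig l ⟨v, hv0, hv⟩
    have hy := hQeig (μ - l) ⟨fun i => (fun j => x (i, j)) ⬝ᵥ v, fun h => hrv (congrFun h i0), by
      ext i
      have h1 : (Q.mulVec fun i => (fun j => x (i, j)) ⬝ᵥ v) i =
          (fun j => (Q.mulVec fun i' => x (i', j)) i) ⬝ᵥ v := by
        simp only [Matrix.mulVec, dotProduct, Finset.mul_sum, Finset.sum_mul]
        rw [Finset.sum_comm]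
        simp only [mul_assoc]
      have h2 : (fun j => (Q.mulVec fun i' => x (i', j)) i) =
          μ • (fun j => x (i, j)) - M.mulVec (fun j => x (i, j)) := by
        ext j
        have := congrFun hx (i, j)
        rw [hS] at this
        simp only [Pi.smul_apply, Pi.sub_apply] at this ⊢
        linarith
      have h3 : M.mulVec (fun j => x (i, j)) ⬝ᵥ v = l * ((fun j => x (i, j)) ⬝ᵥ v) := by
        rw [dotProduct_comm, Matrix.dotProduct_mulVec, ← Matrix.mulVec_transpose, hMsymm.eq, hv,
          smul_dotProduct, dotProduct_comm, smul_eq_mul]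
      rw [h1, h2, sub_dotProduct, h3, smul_dotProduct]
      simp only [Pi.smul_apply, smul_eq_mul]
      ring⟩
    rcases hl with hl | hl <;> rcases hy with hy | hy
    · left; linarith
    · right; linarith
    · right; linarith
    · right; linarith
end

section
/- Let V be a finite nonempty type carrying a weighted 2-complex (m₀, m₁, m₂, c₀, c₁), and let E be a real inner product space. Then for every antisymmetric map φ : V → V → E the following Garland-type identity holds: (1/6) * ∑_{u,v,w} m₂ u v w * ‖φ v w − φ u w + φ u v‖² = ∑_v ( (1/2) * ∑_{u,w} m₂ v u w * ‖φ v u − φ v w‖² − (c₁/2) * ∑_u m₁ v u * ‖φ v u‖² ). -/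
/-- Garland-type localization identity (Lemma 3.2 of the paper for `k = 1`,
untwisted): for an antisymmetric 1-cochain `φ` with values in a real inner
product space on a weighted 2-complex,
`‖dφ‖² = ∑_v ( ‖d_v φ_v‖² − (c₁/2) ‖φ_v‖² )`. -/
theorem stmt_3 (V : Type*) [Fintype V] [Nonempty V] [DecidableEq V]
    (E : Type*) [NormedAddCommGroup E] [InnerProductSpace ℝ E]
    (m₀ : V → ℝ) (m₁ : V → V → ℝ) (m₂ : V → V → V → ℝ) (c₀ c₁ : ℝ)
    (hm₀ : ∀ v, 0 < m₀ v)
    (hm₁symm : ∀ u v, m₁ u v = m₁ v u)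
    (hm₁nonneg : ∀ u v, 0 ≤ m₁ u v)
    (hm₁diag : ∀ v, m₁ v v = 0)
    (hm₂symm₁ : ∀ u v w, m₂ u v w = m₂ v u w)
    (hm₂symm₂ : ∀ u v w, m₂ u v w = m₂ u w v)
    (hm₂nonneg : ∀ u v w, 0 ≤ m₂ u v w)
    (hm₂diag : ∀ u v w, u = v ∨ u = w ∨ v = w → m₂ u v w = 0)
    (hc₀ : 0 < c₀) (hc₁ : 0 < c₁)
    (hdeg₁ : ∀ v, ∑ u, m₁ v u = c₀ * m₀ v)
    (hdeg₂ : ∀ u v, ∑ w, m₂ u v w = c₁ * m₁ u v)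
    (φ : V → V → E) (hφ : ∀ u v, φ u v = -φ v u) :
    (1/6) * ∑ u, ∑ v, ∑ w, m₂ u v w * ‖φ v w - φ u w + φ u v‖^2 =
    ∑ v, ((1/2) * ∑ u, ∑ w, m₂ v u w * ‖φ v u - φ v w‖^2
      - (c₁/2) * ∑ u, m₁ v u * ‖φ v u‖^2) := by
  have hrot : ∀ f : V → V → V → ℝ, ∑ u, ∑ v, ∑ w, f v w u = ∑ u, ∑ v, ∑ w, f u v w := by
    intro f
    rw [Finset.sum_comm]
    refine Finset.sum_congr rfl fun u _ => ?_
    rw [Finset.sum_comm]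
  set G : V → V → V → ℝ := fun v u w => m₂ v u w * ‖φ v u - φ v w‖^2 with hG
  set H : V → V → V → ℝ := fun v u w => m₂ v u w * ‖φ v u‖^2 with hH
  have key : ∀ u v w, m₂ u v w * ‖φ v w - φ u w + φ u v‖^2
      = (G u v w + G v w u + G w u v) - (H u v w + H v w u + H w u v) := by
    intro u v w
    have e1 : m₂ v w u = m₂ u v w := by rw [hm₂symm₂, hm₂symm₁]
    have e2 : m₂ w u v = m₂ u v w := by rw [hm₂symm₁, hm₂symm₂]
    simp only [hG, hH, e1, e2]
    rw [hφ v u, hφ w v, hφ u w]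
    generalize φ u v = a
    generalize φ v w = b
    generalize φ w u = c
    simp only [← real_inner_self_eq_norm_sq, inner_add_left, inner_add_right, inner_sub_left,
      inner_sub_right, inner_neg_left, inner_neg_right]
    rw [real_inner_comm a b, real_inner_comm a c, real_inner_comm b c]
    ring
  have hH1 : ∀ v, c₁ * ∑ u, m₁ v u * ‖φ v u‖^2 = ∑ u, ∑ w, H v u w := by
    intro v
    rw [Finset.mul_sum]
    refine Finset.sum_congr rfl fun u _ => ?_
    simp only [hH]
    rw [← Finset.sum_mul, hdeg₂]
    ring
  have hR : ∀ v, (1/2) * ∑ u, ∑ w, m₂ v u w * ‖φ v u - φ v w‖^2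
      - (c₁/2) * ∑ u, m₁ v u * ‖φ v u‖^2
      = (1/2) * ∑ u, ∑ w, G v u w - (1/2) * ∑ u, ∑ w, H v u w := by
    intro v
    rw [← hH1]
    ring
  simp only [hR, key, Finset.sum_sub_distrib, Finset.sum_add_distrib, ← Finset.mul_sum]
  have g1 := hrot G
  have g2 := hrot (fun a b c => G b c a)
  have h1 := hrot H
  have h2 := hrot (fun a b c => H b c a)
  rw [g2, h2, g1, h1]
  ring
end

section
/- Let V be a finite nonempty type carrying a weighted 2-complex (m₀, m₁, m₂, c₀, c₁), and let λ > 0 be a real number. Assume that for every vertex v the link of v has spectral gap at least λ. Then for every antisymmetric map φ : V → V → ℝ: (1/6) * ∑_{u,v,w} m₂ u v w * (φ v w − φ u w + φ u v)² ≥ 2*(λ − c₁/2) * (1/2) * ∑_{u,v} m₁ u v * (φ u v)² − (λ/c₀) * ∑_v m₀ v * (δφ v)², where δφ v = (m₀ v)⁻¹ * ∑_u m₁ u v * φ u v. -/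
theorem cyc_aux {V : Type*} [Fintype V] (F : V → V → V → ℝ) :
    ∑ u, ∑ v, ∑ w, F v w u = ∑ u, ∑ v, ∑ w, F u v w := by
  rw [Finset.sum_comm]
  refine Finset.sum_congr rfl fun v _ => ?_
  rw [Finset.sum_comm]

/-- The main estimate in Theorem 3.3 of the paper (k = 1, untwisted): if every
vertex link has spectral gap at least `lam`, then
`‖dφ‖² ≥ 2(λ − c₁/2)‖φ‖² − (λ/c₀)‖δφ‖²` for every antisymmetric `φ`. -/
theorem stmt_4 (V : Type*) [Fintype V] [Nonempty V] [DecidableEq V]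
    (m₀ : V → ℝ) (m₁ : V → V → ℝ) (m₂ : V → V → V → ℝ) (c₀ c₁ : ℝ)
    (hm₀ : ∀ v, 0 < m₀ v)
    (hm₁symm : ∀ u v, m₁ u v = m₁ v u)
    (hm₁nonneg : ∀ u v, 0 ≤ m₁ u v)
    (hm₁diag : ∀ v, m₁ v v = 0)
    (hm₂symm₁ : ∀ u v w, m₂ u v w = m₂ v u w)
    (hm₂symm₂ : ∀ u v w, m₂ u v w = m₂ u w v)
    (hm₂nonneg : ∀ u v w, 0 ≤ m₂ u v w)
    (hm₂diag : ∀ u v w, u = v ∨ u = w ∨ v = w → m₂ u v w = 0)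
    (hc₀ : 0 < c₀) (hc₁ : 0 < c₁)
    (hdeg₁ : ∀ v, ∑ u, m₁ v u = c₀ * m₀ v)
    (hdeg₂ : ∀ u v, ∑ w, m₂ u v w = c₁ * m₁ u v)
    (lam : ℝ) (hlam : 0 < lam)
    (hgap : ∀ v : V, ∀ f : V → ℝ, (∑ u, m₁ v u * f u) = 0 →
      (1/2) * ∑ u, ∑ w, m₂ v u w * (f u - f w)^2 ≥ lam * ∑ u, m₁ v u * (f u)^2)
    (φ : V → V → ℝ) (hφ : ∀ u v, φ u v = -φ v u) :
    (1/6) * ∑ u, ∑ v, ∑ w, m₂ u v w * (φ v w - φ u w + φ u v)^2 ≥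
      2 * (lam - c₁/2) * ((1/2) * ∑ u, ∑ v, m₁ u v * (φ u v)^2)
      - (lam / c₀) * ∑ v, m₀ v * ((m₀ v)⁻¹ * ∑ u, m₁ u v * φ u v)^2 := by
  have hlink : ∀ v, (1/2) * ∑ u, ∑ w, m₂ v u w * (φ v u - φ v w)^2 ≥
      lam * ∑ u, m₁ v u * (φ v u)^2
        - (lam / c₀) * (m₀ v * ((m₀ v)⁻¹ * ∑ u, m₁ u v * φ u v)^2) := by
    intro v
    have hS : ∑ u, m₁ u v * φ u v = - ∑ u, m₁ v u * φ v u := by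
      rw [← Finset.sum_neg_distrib]
      refine Finset.sum_congr rfl fun u _ => ?_
      rw [hm₁symm u v, hφ u v]; ring
    rw [hS]
    set S := ∑ u, m₁ v u * φ v u with hSdef
    have h0 : m₀ v ≠ 0 := (hm₀ v).ne'
    have h1 : c₀ ≠ 0 := hc₀.ne'
    obtain ⟨t, ht⟩ : ∃ t, t = S / (c₀ * m₀ v) := ⟨_, rfl⟩
    have e1 : ∑ u, m₁ v u * (φ v u - t) = 0 := by
      simp only [mul_sub, Finset.sum_sub_distrib, ← Finset.sum_mul, hdeg₁]
      rw [← hSdef, ht]; field_simp; ring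
    have e2 : ∑ u, m₁ v u * (φ v u - t)^2
        = ∑ u, m₁ v u * (φ v u)^2 - 2 * t * S + t^2 * (c₀ * m₀ v) := by
      rw [← hdeg₁, hSdef, Finset.mul_sum, Finset.mul_sum, ← Finset.sum_sub_distrib,
        ← Finset.sum_add_distrib]
      exact Finset.sum_congr rfl fun u _ => by ring
    have h := hgap v (fun u => φ v u - t) e1
    simp only [sub_sub_sub_cancel_right] at h
    rw [e2] at h
    have e3 : lam * (∑ u, m₁ v u * (φ v u)^2 - 2 * t * S + t^2 * (c₀ * m₀ v))
        = lam * ∑ u, m₁ v u * (φ v u)^2 - (lam / c₀) * (m₀ v * ((m₀ v)⁻¹ * -S)^2) := by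
      rw [ht]; field_simp; ring
    linarith
  have hsum := Finset.sum_le_sum fun v (_ : v ∈ Finset.univ) => hlink v
  rw [Finset.sum_sub_distrib, ← Finset.mul_sum, ← Finset.mul_sum, ← Finset.mul_sum] at hsum
  have hA : ∑ u, ∑ v, ∑ w, m₂ u v w * (φ u v)^2 = c₁ * ∑ u, ∑ v, m₁ u v * (φ u v)^2 := by
    simp only [← Finset.sum_mul, hdeg₂, Finset.mul_sum, mul_assoc]
  have hP : ∑ u, ∑ v, ∑ w, m₂ u v w * (φ v w - φ u w + φ u v)^2
      = 3 * ∑ u, ∑ v, ∑ w, m₂ u v w * (φ u v - φ u w)^2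
        - 3 * ∑ u, ∑ v, ∑ w, m₂ u v w * (φ u v)^2 := by
    have q1 := cyc_aux fun u v w => m₂ u v w * (φ u v - φ u w)^2 - m₂ u v w * (φ u v)^2
    have q2 := cyc_aux fun u v w => m₂ v w u * (φ v w - φ v u)^2 - m₂ v w u * (φ v w)^2
    have q3 : ∑ u, ∑ v, ∑ w, m₂ u v w * (φ v w - φ u w + φ u v)^2
      = ∑ u, ∑ v, ∑ w, (m₂ u v w * (φ u v - φ u w)^2 - m₂ u v w * (φ u v)^2)
      + ∑ u, ∑ v, ∑ w, (m₂ v w u * (φ v w - φ v u)^2 - m₂ v w u * (φ v w)^2)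
      + ∑ u, ∑ v, ∑ w, (m₂ w u v * (φ w u - φ w v)^2 - m₂ w u v * (φ w u)^2) := by
      simp only [← Finset.sum_add_distrib]
      refine Finset.sum_congr rfl fun u _ => Finset.sum_congr rfl fun v _ =>
        Finset.sum_congr rfl fun w _ => ?_
      have a1 : m₂ v w u = m₂ u v w := by rw [hm₂symm₂ v w u, hm₂symm₁ v u w]
      have a2 : m₂ w u v = m₂ u v w := by rw [hm₂symm₁ w u v, hm₂symm₂ u w v]
      rw [a1, a2, hφ v u, hφ w u, hφ w v]; ring
    have q4 : ∑ u, ∑ v, ∑ w, (m₂ u v w * (φ u v - φ u w)^2 - m₂ u v w * (φ u v)^2)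
      = ∑ u, ∑ v, ∑ w, m₂ u v w * (φ u v - φ u w)^2
        - ∑ u, ∑ v, ∑ w, m₂ u v w * (φ u v)^2 := by
      simp only [Finset.sum_sub_distrib]
    linarith
  rw [hP, hA]
  linarith
end

section
/- Let V be a finite nonempty type carrying a weighted 2-complex (m₀, m₁, m₂, c₀, c₁), and let λ be a real number with λ > c₁/2. Assume that for every vertex v the link of v has spectral gap at least λ. Then for every antisymmetric map φ : V → V → ℝ which is a cocycle, i.e., φ v w − φ u w + φ u v = 0 whenever m₂ u v w > 0, one has ∑_v m₀ v * (δφ v)² ≥ (2*c₀*(λ − c₁/2)/λ) * (1/2) * ∑_{u,v} m₁ u v * (φ u v)², where δφ v = (m₀ v)⁻¹ * ∑_u m₁ u v * φ u v. -/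
/-- Theorem 3.3 of the paper (k = 1, untwisted): if every vertex link has
spectral gap at least `lam > c₁/2`, then every 1-cocycle `φ` satisfies
`‖δφ‖² ≥ (2 c₀ (λ − c₁/2) / λ) ‖φ‖²`. -/
theorem stmt_5 (V : Type*) [Fintype V] [Nonempty V] [DecidableEq V]
    (m₀ : V → ℝ) (m₁ : V → V → ℝ) (m₂ : V → V → V → ℝ) (c₀ c₁ : ℝ)
    (hm₀ : ∀ v, 0 < m₀ v)
    (hm₁symm : ∀ u v, m₁ u v = m₁ v u)
    (hm₁nonneg : ∀ u v, 0 ≤ m₁ u v)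
    (hm₁diag : ∀ v, m₁ v v = 0)
    (hm₂symm₁ : ∀ u v w, m₂ u v w = m₂ v u w)
    (hm₂symm₂ : ∀ u v w, m₂ u v w = m₂ u w v)
    (hm₂nonneg : ∀ u v w, 0 ≤ m₂ u v w)
    (hm₂diag : ∀ u v w, u = v ∨ u = w ∨ v = w → m₂ u v w = 0)
    (hc₀ : 0 < c₀) (hc₁ : 0 < c₁)
    (hdeg₁ : ∀ v, ∑ u, m₁ v u = c₀ * m₀ v)
    (hdeg₂ : ∀ u v, ∑ w, m₂ u v w = c₁ * m₁ u v)
    (lam : ℝ) (hlam : c₁ / 2 < lam)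
    (hgap : ∀ v : V, ∀ f : V → ℝ, (∑ u, m₁ v u * f u) = 0 →
      (1/2) * ∑ u, ∑ w, m₂ v u w * (f u - f w)^2 ≥ lam * ∑ u, m₁ v u * (f u)^2)
    (φ : V → V → ℝ) (hφ : ∀ u v, φ u v = -φ v u)
    (hcocycle : ∀ u v w, 0 < m₂ u v w → φ v w - φ u w + φ u v = 0) :
    ∑ v, m₀ v * ((m₀ v)⁻¹ * ∑ u, m₁ u v * φ u v)^2 ≥
      (2 * c₀ * (lam - c₁/2) / lam) * ((1/2) * ∑ u, ∑ v, m₁ u v * (φ u v)^2) := by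
  have hl : 0 < lam := by linarith
  have key : ∀ v, (1/2) * ∑ u, ∑ w, m₂ v u w * (φ u w)^2 ≥
      lam * (∑ u, m₁ v u * (φ v u)^2 - c₀⁻¹ * (m₀ v * ((m₀ v)⁻¹ * ∑ u, m₁ u v * φ u v)^2)) := by
    intro v
    have h0 := (hm₀ v).ne'
    have hc := hc₀.ne'
    obtain ⟨S, hS⟩ : ∃ S, S = ∑ u, m₁ v u * φ v u := ⟨_, rfl⟩
    have hS2 : ∑ u, m₁ u v * φ u v = -S := by
      rw [hS, ← Finset.sum_neg_distrib]
      refine Finset.sum_congr rfl fun u _ => ?_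
      rw [hm₁symm u v, hφ u v]; ring
    obtain ⟨a, ha⟩ : ∃ a, a = S / (c₀ * m₀ v) := ⟨_, rfl⟩
    have h1 : ∑ u, m₁ v u * (φ v u - a) = 0 := by
      simp only [mul_sub, Finset.sum_sub_distrib]
      rw [← Finset.sum_mul, hdeg₁, ← hS, ha]
      field_simp
      ring
    have h2 := hgap v (fun u => φ v u - a) h1
    have h3 : ∑ u, ∑ w, m₂ v u w * ((φ v u - a) - (φ v w - a))^2
        = ∑ u, ∑ w, m₂ v u w * (φ u w)^2 := by
      refine Finset.sum_congr rfl fun u _ => Finset.sum_congr rfl fun w _ => ?_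
      rcases (hm₂nonneg v u w).eq_or_lt with h | h
      · rw [← h]; ring
      · have := hcocycle v u w h
        have e : (φ v u - a) - (φ v w - a) = - φ u w := by linarith
        rw [e]; ring
    have h4 : ∑ u, m₁ v u * (φ v u - a)^2 = ∑ u, m₁ v u * (φ v u)^2
        - c₀⁻¹ * (m₀ v * ((m₀ v)⁻¹ * -S)^2) := by
      have : ∀ u, m₁ v u * (φ v u - a)^2
          = m₁ v u * (φ v u)^2 - 2 * a * (m₁ v u * φ v u) + m₁ v u * a^2 := fun u => by ring
      simp only [this, Finset.sum_add_distrib, Finset.sum_sub_distrib]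
      rw [← Finset.sum_mul, ← Finset.mul_sum, hdeg₁, ← hS, ha]
      field_simp
      ring
    rw [hS2, ← h4, ← h3]
    exact h2
  have hsum := Finset.sum_le_sum fun v (_ : v ∈ Finset.univ) => key v
  rw [← Finset.mul_sum, ← Finset.mul_sum, Finset.sum_sub_distrib, ← Finset.mul_sum] at hsum
  have hN : ∑ v, ∑ u, ∑ w, m₂ v u w * (φ u w)^2 = c₁ * ∑ u, ∑ v, m₁ u v * (φ u v)^2 := by
    rw [Finset.sum_comm, Finset.mul_sum]
    refine Finset.sum_congr rfl fun u _ => ?_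
    rw [Finset.sum_comm, Finset.mul_sum]
    refine Finset.sum_congr rfl fun w _ => ?_
    rw [← Finset.sum_mul, ← mul_assoc, ← hdeg₂]
    congr 1
    refine Finset.sum_congr rfl fun v _ => ?_
    rw [hm₂symm₁, hm₂symm₂]
  rw [hN] at hsum
  generalize ∑ v, m₀ v * ((m₀ v)⁻¹ * ∑ u, m₁ u v * φ u v)^2 = L at *
  generalize ∑ u, ∑ v, m₁ u v * (φ u v)^2 = N at *
  have e : (2 * c₀ * (lam - c₁/2) / lam) * ((1/2) * N) = c₀ * ((lam - c₁/2) * N) / lam := by ring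
  rw [e, ge_iff_le, div_le_iff₀ hl]
  have h5 : (lam - c₁/2) * N ≤ lam * (c₀⁻¹ * L) := by linarith
  calc c₀ * ((lam - c₁/2) * N) ≤ c₀ * (lam * (c₀⁻¹ * L)) := by gcongr
    _ = L * lam := by field_simp
end

section
/- Let V be a finite nonempty type carrying a weighted 2-complex (m₀, m₁, m₂, c₀, c₁), and let μ > 0 be a real number. Assume that the underlying graph of the complex is connected and that for every vertex v the link of v has spectral gap at least μ. Then for every g : V → ℝ with ∑_v m₀ v * g v = 0 one has (1/2) * ∑_{u,v} m₁ u v * (g u − g v)² ≥ (c₀*(2*μ − c₁)/μ) * ∑_v m₀ v * (g v)²; that is, the spectral gap of the whole complex is at least c₀*(−c₁ + 2μ)/μ. -/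
/-- Proposition 3.6 of the paper (local-to-global spectral gap): if the
underlying graph of a weighted 2-complex is connected and every vertex link
has spectral gap at least `μ > 0`, then the whole complex has spectral gap at
least `c₀(2μ − c₁)/μ`. -/
theorem stmt_6 (V : Type*) [Fintype V] [Nonempty V] [DecidableEq V]
    (m₀ : V → ℝ) (m₁ : V → V → ℝ) (m₂ : V → V → V → ℝ) (c₀ c₁ : ℝ)
    (hm₀ : ∀ v, 0 < m₀ v)
    (hm₁symm : ∀ u v, m₁ u v = m₁ v u)
    (hm₁nonneg : ∀ u v, 0 ≤ m₁ u v)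
    (hm₁diag : ∀ v, m₁ v v = 0)
    (hm₂symm₁ : ∀ u v w, m₂ u v w = m₂ v u w)
    (hm₂symm₂ : ∀ u v w, m₂ u v w = m₂ u w v)
    (hm₂nonneg : ∀ u v w, 0 ≤ m₂ u v w)
    (hm₂diag : ∀ u v w, u = v ∨ u = w ∨ v = w → m₂ u v w = 0)
    (hc₀ : 0 < c₀) (hc₁ : 0 < c₁)
    (hdeg₁ : ∀ v, ∑ u, m₁ v u = c₀ * m₀ v)
    (hdeg₂ : ∀ u v, ∑ w, m₂ u v w = c₁ * m₁ u v)
    (G : SimpleGraph V) (hG : ∀ u v, G.Adj u v ↔ u ≠ v ∧ 0 < m₁ u v)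
    (hconn : G.Connected)
    (μ : ℝ) (hμ : 0 < μ)
    (hgap : ∀ v : V, ∀ f : V → ℝ, (∑ u, m₁ v u * f u) = 0 →
      (1/2) * ∑ u, ∑ w, m₂ v u w * (f u - f w)^2 ≥ μ * ∑ u, m₁ v u * (f u)^2) :
    ∀ g : V → ℝ, (∑ v, m₀ v * g v) = 0 →
      (1/2) * ∑ u, ∑ v, m₁ u v * (g u - g v)^2 ≥
        (c₀ * (2 * μ - c₁) / μ) * ∑ v, m₀ v * (g v)^2 := by
  classical
  set E : (V → ℝ) → ℝ := fun g => (1/2) * ∑ u, ∑ v, m₁ u v * (g u - g v)^2 with hE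
  set N : (V → ℝ) → ℝ := fun g => ∑ v, m₀ v * (g v)^2 with hN
  have hE0 : ∀ g, 0 ≤ E g := fun g => by
    have : 0 ≤ ∑ u, ∑ v, m₁ u v * (g u - g v)^2 :=
      Finset.sum_nonneg fun u _ => Finset.sum_nonneg fun v _ =>
        mul_nonneg (hm₁nonneg u v) (sq_nonneg _)
    simp only [hE]; linarith
  have hN0 : ∀ g, 0 ≤ N g := fun g =>
    Finset.sum_nonneg fun v _ => mul_nonneg (hm₀ v).le (sq_nonneg _)
  have hNz : ∀ g, N g = 0 → g = 0 := by
    intro g h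
    funext v
    have := (Finset.sum_eq_zero_iff_of_nonneg
      (fun v _ => mul_nonneg (hm₀ v).le (sq_nonneg (g v)))).1 h v (Finset.mem_univ v)
    have h2 := (hm₀ v).ne'
    simpa [h2] using this
  have hEs : ∀ (t : ℝ) g, E (fun v => t * g v) = t^2 * E g := by
    intro t g
    simp only [hE, Finset.mul_sum]
    refine Finset.sum_congr rfl fun u _ => Finset.sum_congr rfl fun v _ => ?_
    ring
  have hNs : ∀ (t : ℝ) g, N (fun v => t * g v) = t^2 * N g := by
    intro t g
    simp only [hN, Finset.mul_sum]
    refine Finset.sum_congr rfl fun u _ => ?_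
    ring
  intro g₀ hg₀
  change E g₀ ≥ _ * N g₀
  by_cases hNg : N g₀ = 0
  · rw [hNg, mul_zero]; exact hE0 _
  have hNg' : 0 < N g₀ := lt_of_le_of_ne (hN0 _) (Ne.symm hNg)
  let S : Set (V → ℝ) := {g | (∑ v, m₀ v * g v) = 0 ∧ N g = 1}
  have hSmem : ∀ h : V → ℝ, (∑ v, m₀ v * h v) = 0 → 0 < N h →
      (fun v => (1 / √(N h)) * h v) ∈ S := by
    intro h h1 h2
    refine ⟨?_, ?_⟩
    · have : ∑ v, m₀ v * ((1 / √(N h)) * h v) = (1 / √(N h)) * ∑ v, m₀ v * h v := by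
        rw [Finset.mul_sum]
        exact Finset.sum_congr rfl fun v _ => by ring
      rw [this, h1, mul_zero]
    · rw [hNs, div_pow, Real.sq_sqrt h2.le]
      field_simp
  have hNc : Continuous N := by simp only [hN]; fun_prop
  have hEc : Continuous E := by simp only [hE]; fun_prop
  have hScl : IsClosed S := by
    apply IsClosed.inter
    · exact isClosed_eq (by fun_prop) continuous_const
    · exact isClosed_eq hNc continuous_const
  have hScpt : IsCompact S := by
    refine IsCompact.of_isClosed_subset
      (isCompact_univ_pi fun v => isCompact_Icc (a := -(1 / m₀ v + 1)) (b := 1 / m₀ v + 1)) hScl ?_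
    rintro g ⟨-, hg⟩ v -
    have h1 : m₀ v * (g v)^2 ≤ 1 := by
      rw [← hg]
      exact Finset.single_le_sum (f := fun v => m₀ v * (g v)^2)
        (fun v _ => mul_nonneg (hm₀ v).le (sq_nonneg (g v))) (Finset.mem_univ v)
    have h2 : (g v)^2 ≤ 1 / m₀ v := by
      rw [le_div_iff₀ (hm₀ v)]; linarith
    constructor <;> nlinarith [sq_nonneg (g v - 1), sq_nonneg (g v + 1)]
  obtain ⟨g, ⟨hg0, hg1⟩, hmin⟩ := hScpt.exists_isMinOn ⟨_, hSmem g₀ hg₀ hNg'⟩ hEc.continuousOn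
  obtain ⟨l, hl⟩ : ∃ l, l = E g := ⟨_, rfl⟩
  have hray : ∀ h : V → ℝ, (∑ v, m₀ v * h v) = 0 → l * N h ≤ E h := by
    intro h hh
    rcases (hN0 h).eq_or_lt with h0 | h0
    · rw [← h0, mul_zero]; exact hE0 _
    · have h1 := hmin (hSmem h hh h0)
      simp only [Set.mem_setOf_eq] at h1
      rw [hEs, div_pow, Real.sq_sqrt h0.le, ← hl] at h1
      rw [one_pow, div_mul_eq_mul_div, one_mul, le_div_iff₀ h0] at h1
      exact h1
  suffices hK : c₀ * (2 * μ - c₁) / μ ≤ l from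
    (mul_le_mul_of_nonneg_right hK hNg'.le).trans (hray g₀ hg₀)
  -- positivity of l
  have hlpos : 0 < l := by
    refine lt_of_le_of_ne (hl ▸ hE0 g) fun h0 => ?_
    have hE00 : E g = 0 := by rw [← hl, ← h0]
    have hs : ∑ u, ∑ v, m₁ u v * (g u - g v)^2 = 0 := by
      simp only [hE] at hE00; linarith
    have hadj : ∀ u v, G.Adj u v → g u = g v := by
      intro u v huv
      have h1 := (Finset.sum_eq_zero_iff_of_nonneg (fun u _ => Finset.sum_nonneg fun v _ =>
        mul_nonneg (hm₁nonneg u v) (sq_nonneg (g u - g v)))).1 hs u (Finset.mem_univ u)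
      have h2 := (Finset.sum_eq_zero_iff_of_nonneg (fun v _ =>
        mul_nonneg (hm₁nonneg u v) (sq_nonneg (g u - g v)))).1 h1 v (Finset.mem_univ v)
      have h3 := ((hG u v).1 huv).2.ne'
      have h4 : g u - g v = 0 := by simpa [h3] using h2
      linarith
    have hwalk : ∀ u v, G.Walk u v → g u = g v := by
      intro u v p
      induction p with
      | nil => rfl
      | cons h _ ih => exact (hadj _ _ h).trans ih
    obtain ⟨v₀⟩ := (inferInstance : Nonempty V)
    have hconst : ∀ v, g v = g v₀ := fun v => by
      obtain ⟨p⟩ := hconn.preconnected v v₀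
      exact hwalk _ _ p
    have h5 : (∑ v, m₀ v) * g v₀ = 0 := by
      rw [Finset.sum_mul, ← hg0]
      exact Finset.sum_congr rfl fun v _ => by rw [hconst v]
    have h6 : 0 < ∑ v, m₀ v := Finset.sum_pos (fun v _ => hm₀ v) ⟨v₀, Finset.mem_univ _⟩
    have h7 : g v₀ = 0 := (mul_eq_zero.1 h5).resolve_left h6.ne'
    have h8 : N g = 0 := by simp [hN, hconst, h7]
    rw [h8] at hg1
    exact zero_ne_one hg1
  -- Euler-Lagrange equation
  obtain ⟨r, hr⟩ : ∃ r : V → ℝ, ∀ v, r v = ∑ u, m₁ v u * (g v - g u) - l * (m₀ v * g v) :=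
    ⟨_, fun _ => rfl⟩
  have hskew : ∀ k : V → ℝ, ∑ u, ∑ v, m₁ u v * ((g u - g v) * (k u - k v)) =
      2 * ∑ u, k u * ∑ v, m₁ u v * (g u - g v) := by
    intro k
    have h1 : ∑ u, ∑ v, m₁ u v * ((g u - g v) * (k u - k v)) =
        ∑ u, ∑ v, k u * (m₁ u v * (g u - g v)) + ∑ u, ∑ v, k v * (m₁ v u * (g v - g u)) := by
      simp only [← Finset.sum_add_distrib]
      refine Finset.sum_congr rfl fun u _ => Finset.sum_congr rfl fun v _ => ?_
      rw [hm₁symm v u]; ring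
    rw [h1, Finset.sum_comm (f := fun u v => k v * (m₁ v u * (g v - g u)))]
    simp only [Finset.mul_sum]
    simp only [← Finset.sum_add_distrib]
    refine Finset.sum_congr rfl fun u _ => Finset.sum_congr rfl fun v _ => ?_
    ring
  have hsr : ∑ v, r v = 0 := by
    have h := hskew (fun _ => 1)
    simp only [sub_self, mul_zero, Finset.sum_const_zero, one_mul] at h
    simp only [hr, Finset.sum_sub_distrib, ← Finset.mul_sum, hg0]
    linarith
  have hr0 : ∀ v, r v = 0 := by
    obtain ⟨k, hk⟩ : ∃ k : V → ℝ, ∀ v, k v = r v / m₀ v := ⟨_, fun _ => rfl⟩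
    have hmk : ∀ v, m₀ v * k v = r v := fun v => by
      rw [hk]; have := (hm₀ v).ne'; field_simp
    have hk0 : ∑ v, m₀ v * k v = 0 := by simp only [hmk, hsr]
    have hEt : ∀ t : ℝ, E (fun v => g v + t * k v) = l +
        t * (2 * ∑ u, k u * ∑ v, m₁ u v * (g u - g v)) + t^2 * E k := by
      intro t
      rw [← hskew, hl]
      simp only [hE, Finset.mul_sum, ← Finset.sum_add_distrib]
      refine Finset.sum_congr rfl fun u _ => Finset.sum_congr rfl fun v _ => ?_
      ring
    have hNt : ∀ t : ℝ, N (fun v => g v + t * k v) = 1 +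
        t * (2 * ∑ u, k u * (m₀ u * g u)) + t^2 * N k := by
      intro t
      rw [← hg1]
      simp only [hN, Finset.mul_sum, ← Finset.sum_add_distrib]
      refine Finset.sum_congr rfl fun u _ => ?_
      ring
    have hP : ∑ u, k u * r u = ∑ u, k u * ∑ v, m₁ u v * (g u - g v) -
        l * ∑ u, k u * (m₀ u * g u) := by
      rw [Finset.mul_sum, ← Finset.sum_sub_distrib]
      refine Finset.sum_congr rfl fun u _ => ?_
      rw [hr]; ring
    have hq : ∀ t : ℝ, 0 ≤ (E k - l * N k) * (t * t) + (2 * ∑ u, k u * r u) * t + 0 := by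
      intro t
      have h1 := hray (fun v => g v + t * k v) (by
        simp only [mul_add, Finset.sum_add_distrib, hg0]
        have : ∑ v, m₀ v * (t * k v) = t * ∑ v, m₀ v * k v := by
          rw [Finset.mul_sum]; exact Finset.sum_congr rfl fun v _ => by ring
        rw [this, hk0]; ring)
      rw [hEt, hNt] at h1
      rw [hP]
      linarith
    have hd := discrim_le_zero hq
    have hz : ∑ u, k u * r u = 0 := by
      unfold discrim at hd
      have : (∑ u, k u * r u)^2 ≤ 0 := by linarith
      exact pow_eq_zero_iff two_ne_zero |>.1 (le_antisymm this (sq_nonneg _))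
    have hNk : N k = 0 := by
      rw [← hz]
      refine Finset.sum_congr rfl fun u _ => ?_
      rw [← hmk]; ring
    intro v
    rw [← hmk, hNz k hNk]; simp
  -- the eigenvalue equation
  obtain ⟨a, ha⟩ : ∃ a, a = 1 - l / c₀ := ⟨_, rfl⟩
  have hca : c₀ * a = c₀ - l := by rw [ha]; field_simp
  have heig : ∀ v, ∑ u, m₁ v u * g u = c₀ * a * (m₀ v * g v) := by
    intro v
    have h := hr v
    rw [hr0 v] at h
    simp only [mul_sub, Finset.sum_sub_distrib, ← Finset.sum_mul, hdeg₁] at h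
    rw [hca]; linarith
  have hloc : ∀ v, μ * (∑ u, m₁ v u * (g u)^2 - c₀ * a^2 * (m₀ v * (g v)^2)) ≤
      (1/2) * ∑ u, ∑ w, m₂ v u w * (g u - g w)^2 := by
    intro v
    have h := hgap v (fun u => g u - a * g v) (by
      simp only [mul_sub, Finset.sum_sub_distrib, ← Finset.sum_mul, hdeg₁, heig]
      ring)
    have h1 : ∑ u, m₁ v u * (g u - a * g v)^2 =
        ∑ u, m₁ v u * (g u)^2 - c₀ * a^2 * (m₀ v * (g v)^2) := by
      have h2 : ∀ u, m₁ v u * (g u - a * g v)^2 = m₁ v u * (g u)^2 -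
        (m₁ v u * g u) * (2 * a * g v) + m₁ v u * (a * g v)^2 := fun u => by ring
      simp only [h2, Finset.sum_sub_distrib, Finset.sum_add_distrib, ← Finset.sum_mul, hdeg₁, heig]
      ring
    rw [← h1]
    simpa using h
  have hsum := Finset.sum_le_sum fun v (_ : v ∈ Finset.univ) => hloc v
  have hL : ∑ v, μ * (∑ u, m₁ v u * (g u)^2 - c₀ * a^2 * (m₀ v * (g v)^2)) =
      μ * (c₀ - c₀ * a^2) := by
    rw [← Finset.mul_sum, Finset.sum_sub_distrib, ← Finset.mul_sum, Finset.sum_comm]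
    have h1 : ∑ u, ∑ v, m₁ v u * (g u)^2 = c₀ * N g := by
      simp only [hN, Finset.mul_sum]
      refine Finset.sum_congr rfl fun u _ => ?_
      rw [← Finset.sum_mul, Finset.sum_congr rfl fun v _ => hm₁symm v u, hdeg₁]; ring
    rw [h1]
    change μ * (c₀ * N g - c₀ * a^2 * N g) = _
    rw [hg1]; ring
  have hR : ∑ v, (1/2) * ∑ u, ∑ w, m₂ v u w * (g u - g w)^2 = c₁ * l := by
    rw [← Finset.mul_sum, Finset.sum_comm, hl]
    simp only [hE]
    rw [mul_left_comm, Finset.mul_sum (a := c₁)]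
    congr 1
    refine Finset.sum_congr rfl fun u _ => ?_
    rw [Finset.sum_comm, Finset.mul_sum]
    refine Finset.sum_congr rfl fun w _ => ?_
    rw [← Finset.sum_mul, Finset.sum_congr rfl fun v _ =>
      (hm₂symm₁ v u w).trans (hm₂symm₂ u v w), hdeg₂]
    ring
  rw [hL, hR] at hsum
  have h1 : c₀ - c₀ * a^2 = l * (2 - l / c₀) := by
    rw [ha]; field_simp; ring
  rw [h1] at hsum
  have h2 : μ * (2 - l / c₀) ≤ c₁ := by
    refine le_of_mul_le_mul_right ?_ hlpos
    linarith
  have h3 : μ * (2 - l / c₀) * c₀ = 2 * μ * c₀ - μ * l := by field_simp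
  have h4 := mul_le_mul_of_nonneg_right h2 hc₀.le
  rw [div_le_iff₀ hμ]
  linarith
end

section
/- Let V be a finite nonempty type carrying a weighted 2-complex (m₀, m₁, m₂, c₀, c₁), and let E be a real inner product space. Then for every antisymmetric map φ : V → V → E: (1/6) * ∑_{u,v,w} m₂ u v w * ‖φ v w − φ u w + φ u v‖² ≤ 3 * c₁ * (1/2) * ∑_{u,v} m₁ u v * ‖φ u v‖²; that is, the differential on 1-cochains satisfies ‖dφ‖² ≤ 3 c₁ ‖φ‖². -/
/-- Boundedness of the differential on 1-cochains (Proposition 2.4(1) of the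
paper for `k = 1`, untwisted): `‖dφ‖² ≤ 3 c₁ ‖φ‖²`. -/
theorem stmt_10 (V : Type*) [Fintype V] [Nonempty V] [DecidableEq V]
    (E : Type*) [NormedAddCommGroup E] [InnerProductSpace ℝ E]
    (m₀ : V → ℝ) (m₁ : V → V → ℝ) (m₂ : V → V → V → ℝ) (c₀ c₁ : ℝ)
    (hm₀ : ∀ v, 0 < m₀ v)
    (hm₁symm : ∀ u v, m₁ u v = m₁ v u)
    (hm₁nonneg : ∀ u v, 0 ≤ m₁ u v)
    (hm₁diag : ∀ v, m₁ v v = 0)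
    (hm₂symm₁ : ∀ u v w, m₂ u v w = m₂ v u w)
    (hm₂symm₂ : ∀ u v w, m₂ u v w = m₂ u w v)
    (hm₂nonneg : ∀ u v w, 0 ≤ m₂ u v w)
    (hm₂diag : ∀ u v w, u = v ∨ u = w ∨ v = w → m₂ u v w = 0)
    (hc₀ : 0 < c₀) (hc₁ : 0 < c₁)
    (hdeg₁ : ∀ v, ∑ u, m₁ v u = c₀ * m₀ v)
    (hdeg₂ : ∀ u v, ∑ w, m₂ u v w = c₁ * m₁ u v)
    (φ : V → V → E) (hφ : ∀ u v, φ u v = -φ v u) :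
    (1/6) * ∑ u, ∑ v, ∑ w, m₂ u v w * ‖φ v w - φ u w + φ u v‖^2 ≤
      3 * c₁ * ((1/2) * ∑ u, ∑ v, m₁ u v * ‖φ u v‖^2) := by
  have h3 : ∀ a b c : E, ‖a - b + c‖^2 ≤ 3 * (‖a‖^2 + ‖b‖^2 + ‖c‖^2) := by
    intro a b c
    have h : ‖a - b + c‖ ≤ ‖a‖ + ‖b‖ + ‖c‖ :=
      (norm_add_le _ _).trans (by gcongr; exact norm_sub_le _ _)
    have h0 := norm_nonneg (a - b + c)
    have h' : ‖a - b + c‖^2 ≤ (‖a‖ + ‖b‖ + ‖c‖)^2 := by gcongr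
    nlinarith [sq_nonneg (‖a‖ - ‖b‖), sq_nonneg (‖a‖ - ‖c‖), sq_nonneg (‖b‖ - ‖c‖)]
  have e1 : ∑ u, ∑ v, ∑ w, m₂ u v w * ‖φ u v‖^2 = c₁ * ∑ u, ∑ v, m₁ u v * ‖φ u v‖^2 := by
    simp only [← Finset.sum_mul, hdeg₂, Finset.mul_sum, mul_assoc]
  have e2 : ∑ u, ∑ v, ∑ w, m₂ u v w * ‖φ u w‖^2 = ∑ u, ∑ v, ∑ w, m₂ u v w * ‖φ u v‖^2 := by
    refine Finset.sum_congr rfl fun u _ => ?_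
    rw [Finset.sum_comm]
    refine Finset.sum_congr rfl fun v _ => Finset.sum_congr rfl fun w _ => ?_
    rw [hm₂symm₂]
  have e3 : ∑ u, ∑ v, ∑ w, m₂ u v w * ‖φ v w‖^2 = ∑ u, ∑ v, ∑ w, m₂ u v w * ‖φ u w‖^2 := by
    rw [Finset.sum_comm]
    refine Finset.sum_congr rfl fun u _ => Finset.sum_congr rfl fun v _ =>
      Finset.sum_congr rfl fun w _ => ?_
    rw [hm₂symm₁]
  have key : ∑ u, ∑ v, ∑ w, m₂ u v w * ‖φ v w - φ u w + φ u v‖^2 ≤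
      ∑ u, ∑ v, ∑ w, 3 * (m₂ u v w * ‖φ v w‖^2 + m₂ u v w * ‖φ u w‖^2
        + m₂ u v w * ‖φ u v‖^2) := by
    refine Finset.sum_le_sum fun u _ => Finset.sum_le_sum fun v _ =>
      Finset.sum_le_sum fun w _ => ?_
    have := mul_le_mul_of_nonneg_left (h3 (φ v w) (φ u w) (φ u v)) (hm₂nonneg u v w)
    linarith
  simp only [← Finset.mul_sum, Finset.sum_add_distrib] at key
  rw [e3, e2, e1] at key
  linarith
end

section
/- Let V be a finite nonempty type carrying a weighted 2-complex (m₀, m₁, m₂, c₀, c₁). Then for every g : V → ℝ: c₁ * (1/2) * ∑_{u,v} m₁ u v * (g u − g v)² = ∑_w ( (1/2) * ∑_{u,v} m₂ w u v * (g u − g v)² ); that is, c₁ ‖dg‖² equals the sum over all vertices w of ‖d_w g^w‖², where g^w is the restriction of g to the link of w and d_w is the differential of the link of w. -/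
/-- Proposition 2.10 of the paper (untwisted): for a 0-cochain `g`,
`c₁ ‖dg‖²` equals the sum over all vertices `w` of `‖d_w g^w‖²`, the squared
norms of the differentials of the restrictions of `g` to the links. -/
theorem stmt_13 (V : Type*) [Fintype V] [Nonempty V] [DecidableEq V]
    (m₀ : V → ℝ) (m₁ : V → V → ℝ) (m₂ : V → V → V → ℝ) (c₀ c₁ : ℝ)
    (hm₀ : ∀ v, 0 < m₀ v)
    (hm₁symm : ∀ u v, m₁ u v = m₁ v u)
    (hm₁nonneg : ∀ u v, 0 ≤ m₁ u v)
    (hm₁diag : ∀ v, m₁ v v = 0)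
    (hm₂symm₁ : ∀ u v w, m₂ u v w = m₂ v u w)
    (hm₂symm₂ : ∀ u v w, m₂ u v w = m₂ u w v)
    (hm₂nonneg : ∀ u v w, 0 ≤ m₂ u v w)
    (hm₂diag : ∀ u v w, u = v ∨ u = w ∨ v = w → m₂ u v w = 0)
    (hc₀ : 0 < c₀) (hc₁ : 0 < c₁)
    (hdeg₁ : ∀ v, ∑ u, m₁ v u = c₀ * m₀ v)
    (hdeg₂ : ∀ u v, ∑ w, m₂ u v w = c₁ * m₁ u v) :
    ∀ g : V → ℝ,
      c₁ * ((1/2) * ∑ u, ∑ v, m₁ u v * (g u - g v)^2) =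
        ∑ w, ((1/2) * ∑ u, ∑ v, m₂ w u v * (g u - g v)^2) := by
  intro g
  rw [← Finset.mul_sum, mul_left_comm]
  congr 1
  rw [Finset.sum_comm (f := fun w u => ∑ v, m₂ w u v * (g u - g v)^2)]
  simp only [Finset.mul_sum]
  refine Finset.sum_congr rfl fun u _ => ?_
  rw [Finset.sum_comm]
  refine Finset.sum_congr rfl fun v _ => ?_
  rw [← mul_assoc, ← hdeg₂, Finset.sum_mul]
  refine Finset.sum_congr rfl fun w _ => ?_
  rw [hm₂symm₂ u v w, hm₂symm₁ u w v]
end
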